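/- Let S be a compact set of unique completion C in a not angled two-dimensional real normed plane. Then S satisfies the supporting line property: for any pair of distinct parallel supporting lines L and L′ of C, at least one of L, L′ contains a point of S. -/

import Mathlib

open Set

/-- A bounded set is (diametrically) complete if no set of the same diameter
properly contains it. -/
def IsDiamComplete {X : Type*} [MetricSpace X] (C : Set X) : Prop :=
  ¬ ∃ T : Set X, C ⊂ T ∧ Metric.diam T = Metric.diam C

/-- A normed plane is angled if its unit sphere contains two non-collinear
segments `[a,b]` and `[b,c]`. -/
def Angled (E : Type*) [NormedAddCommGroup E] [NormedSpace ℝ E] : Prop :=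
  ∃ a b c : E, ¬ Collinear ℝ ({a, b, c} : Set E) ∧
    segment ℝ a b ∪ segment ℝ b c ⊆ Metric.sphere (0 : E) 1

open Filter Topology in
/-- If `p` maximises `f` over the intersection of the balls of radius `d` centred in a compact set
`S`, then for every direction `w` of the supporting line at `p` some norming functional `g` of a
vector `p - s` of length `d` with `s ∈ S` satisfies `0 ≤ g w`. -/
lemma exists_norming_functional_nonneg {E : Type*} [NormedAddCommGroup E] [NormedSpace ℝ E]
    [FiniteDimensional ℝ E] {S : Set E} (hS : IsCompact S) {d : ℝ} {f : E →ₗ[ℝ] ℝ} {p e w : E}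
    (hp : ∀ s ∈ S, ‖p - s‖ ≤ d) (hmax : ∀ y, (∀ s ∈ S, ‖y - s‖ ≤ d) → f y ≤ f p)
    (he : f e = 1) (hw : f w = 0) :
    ∃ s ∈ S, ∃ g : E →L[ℝ] ℝ, ‖g‖ ≤ 1 ∧ g (p - s) = d ∧ 0 ≤ g w := by
  have step (n : ℕ) : ∃ q : E × (E →L[ℝ] ℝ), q.1 ∈ S ∧ ‖q.2‖ ≤ 1 ∧
      d ≤ q.2 (p + (1 / ((n : ℝ) + 1)) • (w + (1 / ((n : ℝ) + 1)) • e) - q.1) ∧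
      0 ≤ q.2 (w + (1 / ((n : ℝ) + 1)) • e) := by
    have hpos : (0 : ℝ) < 1 / ((n : ℝ) + 1) := by positivity
    generalize (1 / ((n : ℝ) + 1) : ℝ) = ε at hpos
    have hout : ¬ ∀ s ∈ S, ‖p + ε • (w + ε • e) - s‖ ≤ d := by
      intro h
      have := hmax _ h
      simp only [map_add, map_smul, he, hw, smul_eq_mul] at this
      nlinarith
    push Not at hout
    obtain ⟨s, hs, hlt⟩ := hout
    obtain ⟨g, hg, hgx⟩ := exists_dual_vector'' ℝ (p + ε • (w + ε • e) - s)
    have hgx' : g (p + ε • (w + ε • e) - s) = ‖p + ε • (w + ε • e) - s‖ := by simpa using hgx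
    refine ⟨(s, g), hs, hg, by rw [hgx']; exact hlt.le, ?_⟩
    have h1 : g (p - s) ≤ d :=
      (le_abs_self _).trans ((g.le_of_opNorm_le hg _).trans (by simpa using hp s hs))
    have h2 : g (p + ε • (w + ε • e) - s) = g (p - s) + ε * g (w + ε • e) := by
      rw [add_sub_right_comm, map_add, map_smul, smul_eq_mul]
    have h3 : 0 < ε * g (w + ε • e) := by linarith
    exact (pos_of_mul_pos_right h3 hpos.le).le
  choose q hqS hqn hqd hqw using step
  have : ProperSpace (E →L[ℝ] ℝ) := FiniteDimensional.proper ℝ _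
  obtain ⟨⟨s, g⟩, hmem, ψ, hψ, hlim⟩ :=
    (hS.prod (isCompact_closedBall (0 : E →L[ℝ] ℝ) 1)).tendsto_subseq (x := q)
      fun n => ⟨hqS n, by simpa using hqn n⟩
  have hsS : s ∈ S := hmem.1
  have hg : ‖g‖ ≤ 1 := by simpa using hmem.2
  have hl1 : Tendsto (fun n => (q (ψ n)).1) atTop (𝓝 s) :=
    (continuous_fst.tendsto _).comp hlim
  have hl2 : Tendsto (fun n => (q (ψ n)).2) atTop (𝓝 g) :=
    (continuous_snd.tendsto _).comp hlim
  have hε : Tendsto (fun n => (1 / ((ψ n : ℝ) + 1) : ℝ)) atTop (𝓝 0) :=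
    tendsto_one_div_add_atTop_nhds_zero_nat.comp hψ.tendsto_atTop
  have hdir : Tendsto (fun n => w + (1 / ((ψ n : ℝ) + 1) : ℝ) • e) atTop (𝓝 w) := by
    simpa using (hε.smul_const e).const_add w
  have hvec : Tendsto (fun n => p + (1 / ((ψ n : ℝ) + 1) : ℝ) •
      (w + (1 / ((ψ n : ℝ) + 1) : ℝ) • e) - (q (ψ n)).1) atTop (𝓝 (p - s)) := by
    simpa using ((hε.smul hdir).const_add p).sub hl1
  have happ : Continuous fun x : (E →L[ℝ] ℝ) × E => x.1 x.2 := by fun_prop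
  have hlim1 := (happ.tendsto (g, p - s)).comp (hl2.prodMk_nhds hvec)
  have hlim2 := (happ.tendsto (g, w)).comp (hl2.prodMk_nhds hdir)
  have hge : d ≤ g (p - s) := ge_of_tendsto' hlim1 fun n => hqd (ψ n)
  have hle : g (p - s) ≤ d :=
    (le_abs_self _).trans ((g.le_of_opNorm_le hg _).trans (by simpa using hp s hsS))
  exact ⟨s, hsS, g, hg, le_antisymm hle hge, ge_of_tendsto' hlim2 fun n => hqw (ψ n)⟩

lemma dist_le_of_diam_pos {X : Type*} [MetricSpace X] {T : Set X} (hT : 0 < Metric.diam T)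
    {x y : X} (hx : x ∈ T) (hy : y ∈ T) : dist x y ≤ Metric.diam T := by
  refine Metric.dist_le_diam_of_mem ?_ hx hy
  by_contra h
  exact hT.ne' (Metric.diam_eq_zero_of_unbounded h)

/-- Every set of diameter at most `d > 0` containing a set of diameter `d` lies in a complete set
of diameter `d`. -/
lemma exists_isDiamComplete_superset {X : Type*} [MetricSpace X] {S T : Set X}
    (hS : 0 < Metric.diam S) (hST : S ⊆ T)
    (hT : ∀ x ∈ T, ∀ y ∈ T, dist x y ≤ Metric.diam S) :
    ∃ M, T ⊆ M ∧ IsDiamComplete M ∧ Metric.diam M = Metric.diam S := by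
  obtain ⟨M, hTM, hM⟩ := zorn_subset_nonempty
    {M : Set X | ∀ x ∈ M, ∀ y ∈ M, dist x y ≤ Metric.diam S} (by
      intro c hc hchain _
      refine ⟨⋃₀ c, ?_, fun s hs => Set.subset_sUnion_of_mem hs⟩
      rintro x ⟨a, ha, hx⟩ y ⟨b, hb, hy⟩
      rcases hchain.total ha hb with h | h
      · exact hc hb x (h hx) y hy
      · exact hc ha x hx y (h hy)) T hT
  have hMd : Metric.diam M = Metric.diam S :=
    le_antisymm (Metric.diam_le_of_forall_dist_le hS.le hM.prop)
      (Metric.diam_mono (hST.trans hTM) (Metric.isBounded_iff.2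
        ⟨_, fun x hx y hy => hM.prop x hx y hy⟩))
  refine ⟨M, hTM, ?_, hMd⟩
  rintro ⟨U, hMU, hU⟩
  rw [hMd] at hU
  refine hMU.2 (hM.le_of_ge (y := U) (fun x hx y hy => ?_) hMU.1)
  rw [← hU]
  exact dist_le_of_diam_pos (hU ▸ hS) hx hy

/-- A kernel vector of a nonzero functional on a plane, together with any vector outside the
kernel, spans the plane. -/
lemma exists_eq_smul_add_smul {E : Type*} [AddCommGroup E] [Module ℝ E]
    (hdim : Module.finrank ℝ E = 2) {f : E →ₗ[ℝ] ℝ} {q w : E} (hq : f q ≠ 0)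
    (hw : f w = 0) (hw0 : w ≠ 0) (x : E) : ∃ a b : ℝ, x = a • q + b • w := by
  have : FiniteDimensional ℝ E := FiniteDimensional.of_finrank_pos (by omega)
  have hf : f ≠ 0 := fun h => hq (by simp [h])
  have hker : Module.finrank ℝ (LinearMap.ker f) = 1 := by
    have := Module.Dual.finrank_ker_add_one_of_ne_zero (f := f) hf
    omega
  obtain ⟨b, hb⟩ := (finrank_eq_one_iff_of_nonzero' (⟨w, hw⟩ : LinearMap.ker f)
    (fun h => hw0 (congrArg Subtype.val h))).1 hker
    ⟨x - (f x / f q) • q, by simp [hq]⟩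
  refine ⟨f x / f q, b, ?_⟩
  have := congrArg Subtype.val hb
  simp only [Submodule.coe_smul] at this
  rw [this]
  abel

lemma segment_subset_sphere_of_functional {E : Type*} [NormedAddCommGroup E] [NormedSpace ℝ E]
    {x y : E} (hx : ‖x‖ = 1) (hy : ‖y‖ = 1) {h : E →L[ℝ] ℝ} (hh : ‖h‖ ≤ 1)
    (hhx : h x = 1) (hhy : h y = 1) : segment ℝ x y ⊆ Metric.sphere (0 : E) 1 := by
  rintro z ⟨a, b, ha, hb, hab, rfl⟩
  rw [mem_sphere_zero_iff_norm]
  apply le_antisymm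
  · calc ‖a • x + b • y‖ ≤ ‖a • x‖ + ‖b • y‖ := norm_add_le _ _
      _ = 1 := by rw [norm_smul, norm_smul, hx, hy, Real.norm_of_nonneg ha,
                    Real.norm_of_nonneg hb]; linarith
  · have h1 : h (a • x + b • y) = 1 := by simp [hhx, hhy, hab]
    have h2 := (le_abs_self _).trans (h.le_of_opNorm_le hh (a • x + b • y))
    rw [h1] at h2
    linarith

/-- Two functionals of norm at most one norming a common vector `u`, and also vectors `v₁`, `v₂`
on which `f` differs from its value at `u`, force the plane to be angled as soon as the functionals
take opposite signs along the kernel of `f`. -/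
lemma angled_of_norming_functionals {E : Type*} [NormedAddCommGroup E] [NormedSpace ℝ E]
    (hdim : Module.finrank ℝ E = 2) {f : E →ₗ[ℝ] ℝ} {w u v₁ v₂ : E} (hw : f w = 0)
    (hw0 : w ≠ 0) {h₁ h₂ : E →L[ℝ] ℝ} (hn₁ : ‖h₁‖ ≤ 1) (hn₂ : ‖h₂‖ ≤ 1)
    (hu : ‖u‖ = 1) (hv₁ : ‖v₁‖ = 1) (hv₂ : ‖v₂‖ = 1)
    (hu₁ : h₁ u = 1) (hu₂ : h₂ u = 1) (hhv₁ : h₁ v₁ = 1) (hhv₂ : h₂ v₂ = 1)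
    (hf₁ : f v₁ ≠ f u) (hf₂ : f v₂ ≠ f u) (hw₁ : 0 < h₁ w) (hw₂ : h₂ w < 0) :
    Angled E := by
  refine ⟨v₁, u, v₂, fun hcol => ?_, union_subset
    (segment_subset_sphere_of_functional hv₁ hu hn₁ hhv₁ hu₁)
    (segment_subset_sphere_of_functional hu hv₂ hn₂ hu₂ hhv₂)⟩
  obtain ⟨q, hq⟩ := (collinear_iff_of_mem (p₀ := u) (by simp)).1 hcol
  obtain ⟨r₁, hr₁⟩ := hq v₁ (by simp)
  obtain ⟨r₂, hr₂⟩ := hq v₂ (by simp)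
  rw [vadd_eq_add] at hr₁ hr₂
  subst hr₁ hr₂
  simp only [map_add, map_smul, smul_eq_mul, hu₁, hu₂, add_eq_right, ne_eq,
    mul_eq_zero, not_or] at hhv₁ hhv₂ hf₁ hf₂
  have hq₁ : h₁ q = 0 := hhv₁.resolve_left hf₁.1
  have hq₂ : h₂ q = 0 := hhv₂.resolve_left hf₂.1
  obtain ⟨a, b, rfl⟩ := exists_eq_smul_add_smul hdim hf₁.2 hw hw0 u
  simp only [map_add, map_smul, smul_eq_mul, hq₁, hq₂, mul_zero, zero_add] at hu₁ hu₂
  have hb : 0 < b := pos_of_mul_pos_left (by linarith) hw₁.le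
  nlinarith

/-- The combination of `g` and `g'` vanishing at a kernel vector `w` of `f` is a multiple of
`f`. -/
lemma mul_sub_mul_eq_mul_of_ker {E : Type*} [NormedAddCommGroup E] [NormedSpace ℝ E]
    (hdim : Module.finrank ℝ E = 2) {f : E →ₗ[ℝ] ℝ} {e w : E} (he : f e = 1)
    (hw : f w = 0) (hw0 : w ≠ 0) (g g' : E →L[ℝ] ℝ) (x : E) :
    g' w * g x - g w * g' x = (g' w * g e - g w * g' e) * f x := by
  obtain ⟨a, b, rfl⟩ := exists_eq_smul_add_smul hdim (he ▸ one_ne_zero) hw hw0 x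
  simp only [map_add, map_smul, smul_eq_mul, he, hw]
  ring

theorem supporting_line_property {E : Type*} [NormedAddCommGroup E] [NormedSpace ℝ E]
    (hdim : Module.finrank ℝ E = 2) (hang : ¬ Angled E)
    (S C : Set E) (hcpt : IsCompact S) (hSd : 0 < Metric.diam S)
    -- C is the unique completion of S
    (hC : IsDiamComplete C) (hSC : S ⊆ C) (hCd : Metric.diam C = Metric.diam S)
    (huniq : ∀ C' : Set E, IsDiamComplete C' → S ⊆ C' →
      Metric.diam C' = Metric.diam S → C' = C)
    -- L = {f = c} and L' = {f = c'} are distinct parallel supporting lines of C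
    (f : E →ₗ[ℝ] ℝ) (hf : f ≠ 0) (c c' : ℝ) (hcc : c' ≠ c)
    (hbetween : ∀ x ∈ C, c' ≤ f x ∧ f x ≤ c)
    (htouch : ∃ x ∈ C, f x = c) (htouch' : ∃ x ∈ C, f x = c') :
    ∃ x ∈ S, f x = c ∨ f x = c' := by
  by_contra hno
  push Not at hno
  have : FiniteDimensional ℝ E := FiniteDimensional.of_finrank_pos (by omega)
  obtain ⟨p, hpC, hp⟩ := htouch
  obtain ⟨p', hpC', hp'⟩ := htouch'
  have hdist : ∀ x ∈ C, ∀ y ∈ C, ‖x - y‖ ≤ Metric.diam S := fun x hx y hy => by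
    rw [← dist_eq_norm, ← hCd]
    exact dist_le_of_diam_pos (hCd ▸ hSd) hx hy
  have hball : ∀ y, (∀ s ∈ S, ‖y - s‖ ≤ Metric.diam S) → y ∈ C := by
    intro y hy
    obtain ⟨M, hM, hMc, hMd⟩ := exists_isDiamComplete_superset hSd (subset_insert y S) (by
      rintro a (rfl | ha) b (rfl | hb)
      · simpa using hSd.le
      · rw [dist_eq_norm]; exact hy b hb
      · rw [dist_comm, dist_eq_norm]; exact hy a ha
      · exact dist_le_of_diam_pos hSd ha hb)
    rw [← huniq M hMc ((subset_insert y S).trans hM) hMd]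
    exact hM (mem_insert y S)
  generalize Metric.diam S = d at *
  obtain ⟨e, he⟩ : ∃ e, f e = 1 := by
    obtain ⟨x, hx⟩ := DFunLike.ne_iff.1 hf
    exact ⟨(f x)⁻¹ • x, by simpa using inv_mul_cancel₀ hx⟩
  obtain ⟨w, hw, hw0⟩ : ∃ w, f w = 0 ∧ w ≠ 0 := by
    have hker := Module.Dual.finrank_ker_add_one_of_ne_zero (f := f) hf
    have : Nontrivial (LinearMap.ker f) :=
      Module.nontrivial_of_finrank_pos (R := ℝ) (by omega)
    obtain ⟨x, hx⟩ := exists_ne (0 : LinearMap.ker f)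
    exact ⟨x, x.2, fun h => hx (Subtype.ext h)⟩
  have hgle : ∀ g : E →L[ℝ] ℝ, ‖g‖ ≤ 1 → ∀ x ∈ C, ∀ y ∈ C, g x - g y ≤ d := by
    intro g hg x hx y hy
    rw [← map_sub]
    exact (le_abs_self _).trans
      ((g.le_of_opNorm_le hg _).trans (by simpa using hdist x hx y hy))
  have hcc' : c' < c := lt_of_le_of_ne (hp ▸ (hbetween p hpC).1) hcc
  have hfact : ∀ g : E →L[ℝ] ℝ, ∀ w, f w = 0 → w ≠ 0 → g w = 0 → ∀ x, g x = g e * f x := by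
    intro g w hw hw0 hgw x
    obtain ⟨a, b, rfl⟩ := exists_eq_smul_add_smul hdim (he ▸ one_ne_zero) hw hw0 x
    simp [he, hw, hgw, mul_comm]
  have hside : ∀ w, f w = 0 → w ≠ 0 → ∃ h : E →L[ℝ] ℝ, ‖h‖ ≤ 1 ∧ 0 < h w ∧
      h (p - p') = d ∧ ∃ v, ‖v‖ ≤ d ∧ h v = d ∧ f v ≠ f (p - p') := by
    intro w hw hw0
    obtain ⟨s, hs, g, hg, hgs, hgw⟩ := exists_norming_functional_nonneg (f := f) hcpt
      (fun s hs => hdist p hpC s (hSC hs)) (fun y hy => hp ▸ (hbetween y (hball y hy)).2) he hw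
    obtain ⟨s', hs', g', hg', hgs', hgw'⟩ := exists_norming_functional_nonneg (f := -f)
      (e := -e) (w := -w) hcpt
      (fun s hs => hdist p' hpC' s (hSC hs))
      (fun y hy => by simpa [hp'] using (hbetween y (hball y hy)).1) (by simp [he]) (by simp [hw])
    have hsC := hSC hs
    have hsC' := hSC hs'
    have hfs := (hbetween s hsC).1.lt_of_ne (hno s hs).2.symm
    have hfs' := (hbetween s' hsC').2.lt_of_ne (hno s' hs').1
    rw [map_sub] at hgs hgs'
    obtain ⟨g', rfl⟩ : ∃ k, g' = -k := ⟨-g', (neg_neg g').symm⟩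
    simp only [norm_neg, neg_apply, map_neg, neg_neg] at hg' hgs' hgw'
    have hpos : 0 < g w := by
      refine hgw.lt_of_ne fun h0 => ?_
      have key := hfact g w hw hw0 h0.symm
      have hle := hgle g hg p hpC p' hpC'
      rw [key p, key s, hp] at hgs
      rw [key p, key p', hp, hp'] at hle
      have : 0 < g e := pos_of_mul_pos_left (b := c - f s) (by linarith)
        (by linarith [(hbetween s hsC).2])
      nlinarith
    have hpos' : 0 < g' w := by
      refine hgw'.lt_of_ne fun h0 => ?_
      have key := hfact g' w hw hw0 h0.symm
      have hle := hgle g' hg' p hpC p' hpC'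
      rw [key p', key s', hp'] at hgs'
      rw [key p, key p', hp, hp'] at hle
      have : 0 < g' e := pos_of_mul_pos_left (b := f s' - c') (by linarith)
        (by linarith [(hbetween s' hsC').1])
      nlinarith
    have hid := mul_sub_mul_eq_mul_of_ker hdim he hw hw0 g g'
    rcases le_total 0 (g' w * g e - g w * g' e) with hk | hk
    · refine ⟨g, hg, hpos, ?_, p - s, hdist p hpC s hsC, by rw [map_sub, hgs], by
        rw [map_sub, map_sub, hp, hp']; intro h; linarith⟩
      rw [map_sub]
      refine le_antisymm (hgle g hg p hpC p' hpC') ?_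
      have h1 : 0 ≤ g w * (g' s - g' p') :=
        mul_nonneg hpos.le (by linarith [hgle g' hg' s' hsC' s hsC])
      have h2 := mul_nonneg hk (show 0 ≤ f s - f p' by linarith)
      have h3 : 0 ≤ g s - g p' :=
        nonneg_of_mul_nonneg_right (by linarith [hid s, hid p']) hpos'
      linarith
    · refine ⟨g', hg', hpos', ?_, s' - p', hdist s' hsC' p' hpC', by rw [map_sub]; linarith, by
        rw [map_sub, map_sub, hp, hp']; intro h; linarith⟩
      rw [map_sub]
      refine le_antisymm (hgle g' hg' p hpC p' hpC') ?_
      have h1 : 0 ≤ g' w * (g p - g s') :=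
        mul_nonneg hpos'.le (by linarith [hgle g hg s' hsC' s hsC])
      have h2 := mul_nonneg (neg_nonneg.2 hk) (show 0 ≤ f p - f s' by linarith)
      have h3 : 0 ≤ g' p - g' s' :=
        nonneg_of_mul_nonneg_right (by linarith [hid s', hid p]) hpos
      linarith
  obtain ⟨h₁, hn₁, hw₁, hu₁, v₁, hv₁, hhv₁, hf₁⟩ := hside w hw hw0
  obtain ⟨h₂, hn₂, hw₂, hu₂, v₂, hv₂, hhv₂, hf₂⟩ := hside (-w) (by simp [hw]) (by simpa using hw0)
  have hnorm : ∀ h : E →L[ℝ] ℝ, ‖h‖ ≤ 1 → ∀ v, ‖v‖ ≤ d → h v = d → ‖d⁻¹ • v‖ = 1 := by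
    intro h hh v hv hhv
    have hle := (le_abs_self _).trans (h.le_of_opNorm_le hh v)
    rw [norm_smul, Real.norm_of_nonneg (inv_nonneg.2 hSd.le),
      show ‖v‖ = d by linarith, inv_mul_cancel₀ hSd.ne']
  have hval : ∀ h : E →L[ℝ] ℝ, ∀ v, h v = d → h (d⁻¹ • v) = 1 := fun h v hhv => by
    rw [map_smul, hhv, smul_eq_mul, inv_mul_cancel₀ hSd.ne']
  have hfd : ∀ v, f v ≠ f (p - p') → f (d⁻¹ • v) ≠ f (d⁻¹ • (p - p')) := fun v hv h => by
    rw [map_smul, map_smul, smul_eq_mul, smul_eq_mul] at h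
    exact hv (mul_left_cancel₀ (inv_ne_zero hSd.ne') h)
  exact hang (angled_of_norming_functionals hdim hw hw0 hn₁ hn₂
    (hnorm h₁ hn₁ _ (hdist p hpC p' hpC') hu₁) (hnorm h₁ hn₁ _ hv₁ hhv₁)
    (hnorm h₂ hn₂ _ hv₂ hhv₂) (hval _ _ hu₁) (hval _ _ hu₂) (hval _ _ hhv₁) (hval _ _ hhv₂)
    (hfd _ hf₁) (hfd _ hf₂) hw₁ (by simpa using hw₂))
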